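/- (Tweedie's formula in the DDPM parameterization.) Let ᾱ ∈ (0,1). Let X₀ be an integrable random vector in ℝ^D whose law has a probability density with respect to Lebesgue measure, let Z be a standard Gaussian random vector in ℝ^D independent of X₀, and set X_t = √ᾱ · X₀ + √(1−ᾱ) · Z. Let q be the Lebesgue density of X_t. Then, almost surely, E[X₀ ∣ X_t] = ( X_t + (1−ᾱ) · ∇(log q)(X_t) ) / √ᾱ. -/

import Mathlib

open MeasureTheory ProbabilityTheory Real

/-- **Bayes' formula** for the conditional expectation when the pair `(X, Y)` has a density. -/
theorem condExp_comap_ae_eq_of_map_prodMk_eq_withDensity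
    {Ω E F : Type*} [MeasurableSpace Ω] {μ : Measure Ω} [IsProbabilityMeasure μ]
    [NormedAddCommGroup E] [NormedSpace ℝ E] [CompleteSpace E] [SecondCountableTopology E]
    [MeasurableSpace E] [BorelSpace E] [MeasurableSpace F]
    {α : Measure E} [SFinite α] {β : Measure F} [SFinite β]
    {X : Ω → E} {Y : Ω → F} {k : E × F → ℝ}
    (hX : Measurable X) (hY : Measurable Y) (hX_int : Integrable X μ)
    (hk : Measurable k) (hk_nonneg : ∀ z, 0 ≤ k z)
    (hlaw : μ.map (fun ω => (X ω, Y ω)) =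
      (α.prod β).withDensity (fun z => ENNReal.ofReal (k z))) :
    μ[X | MeasurableSpace.comap Y inferInstance] =ᵐ[μ]
      fun ω => (∫ x, k (x, Y ω) ∂α)⁻¹ • ∫ x, k (x, Y ω) • x ∂α := by
  have hXY : Measurable fun ω => (X ω, Y ω) := hX.prodMk hY
  have hk_ofReal : Measurable fun z => ENNReal.ofReal (k z) := hk.ennreal_ofReal
  have hk_int : Integrable k (α.prod β) := by
    refine ⟨hk.aestronglyMeasurable, ?_⟩
    rw [hasFiniteIntegral_iff_ofReal (.of_forall hk_nonneg), ← setLIntegral_univ,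
      ← withDensity_apply _ .univ, ← hlaw]
    exact measure_lt_top _ _
  have hkx_int : Integrable (fun z : E × F => k z • z.1) (α.prod β) := by
    have h : Integrable (fun z : E × F => z.1) (μ.map fun ω => (X ω, Y ω)) :=
      (integrable_map_measure measurable_fst.aestronglyMeasurable hXY.aemeasurable).2 hX_int
    rw [hlaw, integrable_withDensity_iff_integrable_smul' hk_ofReal (by simp)] at h
    simpa [ENNReal.toReal_ofReal, hk_nonneg] using h
  set q : F → ℝ := fun y => ∫ x, k (x, y) ∂α
  set N : F → E := fun y => ∫ x, k (x, y) • x ∂α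
  have hq_meas : StronglyMeasurable q :=
    StronglyMeasurable.integral_prod_left (f := fun x y => k (x, y)) hk.stronglyMeasurable
  have hN_meas : StronglyMeasurable N :=
    StronglyMeasurable.integral_prod_left (f := fun x y => k (x, y) • x)
      (hk.smul measurable_fst).stronglyMeasurable
  have hq_nonneg : ∀ y, 0 ≤ q y := fun y => integral_nonneg fun x => hk_nonneg _
  have hG_meas : StronglyMeasurable fun y => (q y)⁻¹ • N y :=
    hq_meas.measurable.inv.stronglyMeasurable.smul hN_meas
  have hlawY : μ.map Y = β.withDensity (fun y => ENNReal.ofReal (q y)) := by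
    have h : μ.map Y = (μ.map fun ω => (X ω, Y ω)).map Prod.snd := by
      rw [Measure.map_map measurable_snd hXY]; rfl
    ext B hB
    rw [h, hlaw, Measure.map_apply measurable_snd hB, withDensity_apply _ (measurable_snd hB),
      withDensity_apply _ hB, ← Set.univ_prod, ← Measure.prod_restrict, Measure.restrict_univ,
      lintegral_prod_symm _ hk_ofReal.aemeasurable]
    refine lintegral_congr_ae (ae_restrict_of_ae ?_)
    filter_upwards [hk_int.prod_left_ae] with y hy
    exact (ofReal_integral_eq_lintegral_ofReal hy (.of_forall fun x => hk_nonneg _)).symm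
  have hqG : ∀ᵐ y ∂β, q y • (q y)⁻¹ • N y = N y := by
    filter_upwards [hk_int.prod_left_ae] with y hy
    rcases eq_or_ne (q y) 0 with h0 | h0
    · have h := (integral_eq_zero_iff_of_nonneg (fun x => hk_nonneg (x, y)) hy).1 h0
      have hN0 : N y = 0 := integral_eq_zero_of_ae <| by
        filter_upwards [h] with x hx
        simp only [Pi.zero_apply] at hx ⊢
        rw [hx, zero_smul]
      simp [hN0]
    · rw [smul_inv_smul₀ h0]
  have hG_int : Integrable (fun y => (q y)⁻¹ • N y) (μ.map Y) := by
    rw [hlawY, integrable_withDensity_iff_integrable_smul' hq_meas.measurable.ennreal_ofReal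
      (by simp)]
    refine hkx_int.integral_prod_right.congr ?_
    filter_upwards [hqG] with y hy
    rw [ENNReal.toReal_ofReal (hq_nonneg y), hy]
  refine (ae_eq_condExp_of_forall_setIntegral_eq hY.comap_le hX_int
    (g := fun ω => (q (Y ω))⁻¹ • N (Y ω)) ?_ ?_ ?_).symm
  · exact fun s _ _ => (hG_int.comp_measurable hY).integrableOn
  · rintro _ ⟨B, hB, rfl⟩ -
    have hl : ∫ ω in Y ⁻¹' B, (q (Y ω))⁻¹ • N (Y ω) ∂μ = ∫ y in B, N y ∂β := by
      rw [← setIntegral_map (f := fun y => (q y)⁻¹ • N y) hB hG_meas.aestronglyMeasurable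
        hY.aemeasurable, hlawY, setIntegral_withDensity_eq_setIntegral_toReal_smul
        hq_meas.measurable.ennreal_ofReal (by simp) _ hB]
      refine integral_congr_ae (ae_restrict_of_ae ?_)
      filter_upwards [hqG] with y hy
      rw [ENNReal.toReal_ofReal (hq_nonneg y), hy]
    have hr : ∫ ω in Y ⁻¹' B, X ω ∂μ = ∫ y in B, N y ∂β := by
      have h := setIntegral_map (μ := μ) (f := fun z : E × F => z.1)
        (MeasurableSet.univ.prod hB) measurable_fst.aestronglyMeasurable hXY.aemeasurable
      have hpre : (fun ω => (X ω, Y ω)) ⁻¹' (Set.univ ×ˢ B) = Y ⁻¹' B := by ext; simp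
      rw [hpre] at h
      rw [← h, hlaw, setIntegral_withDensity_eq_setIntegral_toReal_smul hk_ofReal (by simp) _
        (MeasurableSet.univ.prod hB)]
      simp only [ENNReal.toReal_ofReal (hk_nonneg _)]
      have hr_int := hkx_int.restrict (s := Set.univ ×ˢ B)
      rw [← Measure.prod_restrict, Measure.restrict_univ] at hr_int ⊢
      exact integral_prod_symm _ hr_int
    rw [hl, hr]
  · exact (hG_meas.comp_measurable (comap_measurable Y)).aestronglyMeasurable

/-- Affine change of variables for the Lebesgue integral against a Haar measure. -/
theorem lintegral_comp_add_smul {E : Type*} [NormedAddCommGroup E] [NormedSpace ℝ E]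
    [MeasurableSpace E] [BorelSpace E] [FiniteDimensional ℝ E] (ν : Measure E)
    [ν.IsAddHaarMeasure] {f : E → ENNReal} (hf : Measurable f) (c : E) {b : ℝ} (hb : b ≠ 0) :
    ∫⁻ z, f (c + b • z) ∂ν =
      ENNReal.ofReal |(b ^ Module.finrank ℝ E)⁻¹| * ∫⁻ y, f y ∂ν := by
  have hfc : Measurable fun y => f (c + y) := hf.comp (measurable_const_add c)
  rw [← lintegral_map hfc (measurable_const_smul b), Measure.map_addHaar_smul ν hb,
    lintegral_smul_measure, lintegral_add_left_eq_self, smul_eq_mul]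

theorem mul_exp_neg_sq_div_le {s : ℝ} (hs : 0 < s) (t : ℝ) :
    t * exp (-t ^ 2 / (2 * s)) ≤ 1 + s := by
  have h1 : t ^ 2 / (2 * s) + 1 ≤ exp (t ^ 2 / (2 * s)) := add_one_le_exp _
  have h2 : t ≤ (1 + s) * (t ^ 2 / (2 * s) + 1) := by
    have : (1 + s) * (t ^ 2 / (2 * s) + 1) = t ^ 2 / (2 * s) + t ^ 2 / 2 + 1 + s := by
      field_simp; ring
    rw [this]
    nlinarith [sq_nonneg (t - 1), show 0 ≤ t ^ 2 / (2 * s) by positivity]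
  rw [neg_div, exp_neg, ← div_eq_mul_inv, div_le_iff₀ (exp_pos _)]
  exact h2.trans (by gcongr)

theorem hasFDerivAt_exp_neg_norm_sub_sq {E : Type*} [NormedAddCommGroup E]
    [InnerProductSpace ℝ E] (s : ℝ) (c y : E) :
    HasFDerivAt (fun v => exp (-‖v - c‖ ^ 2 / (2 * s)))
      ((exp (-‖y - c‖ ^ 2 / (2 * s)) * s⁻¹) • innerSL ℝ (c - y)) y := by
  have h := (((((hasFDerivAt_id y).sub_const c).norm_sq).neg).mul_const (2 * s)⁻¹).exp
  simp only [← div_eq_mul_inv] at h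
  refine h.congr_fderiv ?_
  ext v
  simp
  ring

theorem norm_const_mul_gaussian_le {E : Type*} [NormedAddCommGroup E] [NormedSpace ℝ E]
    (a C : ℝ) {s : ℝ} (hs : 0 ≤ s) (y x : E) :
    ‖C * exp (-‖y - a • x‖ ^ 2 / (2 * s))‖ ≤ |C| := by
  rw [norm_mul, Real.norm_eq_abs, Real.norm_eq_abs, abs_exp]
  refine mul_le_of_le_one_right (abs_nonneg _) (exp_le_one_iff.2 ?_)
  rw [neg_div]
  exact neg_nonpos.2 (by positivity)

theorem integrable_mul_gaussian {E : Type*} [NormedAddCommGroup E] [NormedSpace ℝ E]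
    [FiniteDimensional ℝ E] [MeasurableSpace E] [BorelSpace E]
    {ν : Measure E} {p : E → ℝ} (hp : Integrable p ν) (a C : ℝ) {s : ℝ} (hs : 0 ≤ s) (y : E) :
    Integrable (fun x => p x * (C * exp (-‖y - a • x‖ ^ 2 / (2 * s)))) ν :=
  hp.mul_bdd (by fun_prop : Continuous fun x : E =>
    C * exp (-‖y - a • x‖ ^ 2 / (2 * s))).aestronglyMeasurable
    (.of_forall (norm_const_mul_gaussian_le a C hs y))

/-- Differentiation under the integral for a Gaussian smoothing. -/
theorem hasGradientAt_integral_mul_gaussian {E : Type*} [NormedAddCommGroup E]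
    [InnerProductSpace ℝ E] [FiniteDimensional ℝ E] [MeasurableSpace E] [BorelSpace E]
    {ν : Measure E} {p : E → ℝ} (hp : Integrable p ν) (hpx : Integrable (fun x => p x • x) ν)
    (a C : ℝ) {s : ℝ} (hs : 0 < s) (y : E) :
    HasGradientAt (fun v => ∫ x, p x * (C * exp (-‖v - a • x‖ ^ 2 / (2 * s))) ∂ν)
      (s⁻¹ • (a • (∫ x, (p x * (C * exp (-‖y - a • x‖ ^ 2 / (2 * s)))) • x ∂ν)
        - (∫ x, p x * (C * exp (-‖y - a • x‖ ^ 2 / (2 * s))) ∂ν) • y)) y := by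
  have hk := integrable_mul_gaussian hp a C hs.le
  have hkx : Integrable (fun x => (p x * (C * exp (-‖y - a • x‖ ^ 2 / (2 * s)))) • x) ν := by
    refine (hpx.bdd_smul |C| (by fun_prop : Continuous fun x : E =>
      C * exp (-‖y - a • x‖ ^ 2 / (2 * s))).aestronglyMeasurable
      (.of_forall (norm_const_mul_gaussian_le a C hs.le y))).congr ?_
    refine .of_forall fun x => ?_
    simp only [Pi.smul_apply', smul_smul, mul_comm (p x)]
  have hsub : Integrable
      (fun x => (p x * (C * exp (-‖y - a • x‖ ^ 2 / (2 * s)))) • (a • x - y)) ν := by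
    refine ((hkx.smul a).sub ((hk y).smul_const y)).congr (.of_forall fun x => ?_)
    simp only [Pi.sub_apply, Pi.smul_apply, smul_sub]
    rw [smul_comm]
  have hgrad : s⁻¹ • (a • (∫ x, (p x * (C * exp (-‖y - a • x‖ ^ 2 / (2 * s)))) • x ∂ν)
        - (∫ x, p x * (C * exp (-‖y - a • x‖ ^ 2 / (2 * s))) ∂ν) • y) =
      s⁻¹ • ∫ x, (p x * (C * exp (-‖y - a • x‖ ^ 2 / (2 * s)))) • (a • x - y) ∂ν := by
    rw [← integral_smul a, ← integral_smul_const]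
    refine congrArg (s⁻¹ • ·) ((integral_sub (hkx.smul a) ((hk y).smul_const y)).symm.trans ?_)
    refine integral_congr_ae (.of_forall fun x => ?_)
    simp only [Pi.smul_apply, smul_sub]
    rw [smul_comm a]
  rw [hgrad, hasGradientAt_iff_hasFDerivAt]
  let F' : E → E → E →L[ℝ] ℝ := fun v x =>
    (p x * C * (exp (-‖v - a • x‖ ^ 2 / (2 * s)) * s⁻¹)) • innerSL ℝ (a • x - v)
  have hF'_meas : AEStronglyMeasurable (F' y) ν :=
    ((hp.aestronglyMeasurable.mul_const C).mul
      (by fun_prop : Continuous fun x : E =>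
        exp (-‖y - a • x‖ ^ 2 / (2 * s)) * s⁻¹).aestronglyMeasurable).smul
      (by fun_prop : Continuous fun x : E => innerSL ℝ (a • x - y)).aestronglyMeasurable
  have hF'_bound : ∀ x v : E, ‖F' v x‖ ≤ ‖p x‖ * (|C| * (s⁻¹ * (1 + s))) := fun x v => by
    have h := mul_exp_neg_sq_div_le hs ‖v - a • x‖
    simp only [F']
    rw [norm_smul, innerSL_apply_norm, norm_sub_rev (a • x) v, norm_mul, norm_mul, norm_mul,
      Real.norm_eq_abs (exp _), abs_exp, Real.norm_of_nonneg (inv_nonneg.2 hs.le),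
      Real.norm_eq_abs C]
    calc _ = ‖p x‖ * (|C| * (s⁻¹ *
          (‖v - a • x‖ * exp (-‖v - a • x‖ ^ 2 / (2 * s))))) := by ring
      _ ≤ _ := by gcongr
  have hbound_int : Integrable (fun x => ‖p x‖ * (|C| * (s⁻¹ * (1 + s)))) ν :=
    hp.norm.mul_const _
  have hmain := hasFDerivAt_integral_of_dominated_of_fderiv_le (μ := ν) (𝕜 := ℝ)
    (F := fun v x => p x * (C * exp (-‖v - a • x‖ ^ 2 / (2 * s)))) (F' := F')
    (s := Set.univ) (x₀ := y) Filter.univ_mem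
    (.of_forall fun v => (hk v).aestronglyMeasurable) (hk y) hF'_meas
    (.of_forall fun x v _ => hF'_bound x v) hbound_int
    (.of_forall fun x v _ => by
      have h := (hasFDerivAt_exp_neg_norm_sub_sq s (a • x) v).const_mul (p x * C)
      simp only [smul_smul] at h
      simpa only [F', mul_assoc] using h)
  refine hmain.congr_fderiv ?_
  have hF'_int : Integrable (F' y) ν :=
    hbound_int.mono' hF'_meas (.of_forall fun x => hF'_bound x y)
  ext w
  rw [ContinuousLinearMap.integral_apply hF'_int, InnerProductSpace.toDual_apply_apply,
    real_inner_smul_left, real_inner_comm, ← integral_inner hsub, ← integral_const_mul]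
  refine integral_congr_ae (.of_forall fun x => ?_)
  simp only [F', smul_apply, innerSL_apply_apply, smul_eq_mul,
    real_inner_smul_right, real_inner_comm w]
  ring

/-- The isotropic Gaussian density of variance `s` rescales to the standard one. -/
theorem gaussian_density_eq_pow_mul {E : Type*} [NormedAddCommGroup E] [NormedSpace ℝ E]
    (D : ℕ) {s : ℝ} (hs : 0 < s) (z : E) :
    (2 * π) ^ (-(D : ℝ) / 2) * exp (-‖z‖ ^ 2 / 2) =
      √s ^ D * ((2 * π * s) ^ (-(D : ℝ) / 2) * exp (-‖√s • z‖ ^ 2 / (2 * s))) := by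
  have hpow : √s ^ D * s ^ (-(D : ℝ) / 2) = 1 := by
    rw [sqrt_eq_rpow, ← rpow_natCast, ← rpow_mul hs.le, ← rpow_add hs,
      show 1 / 2 * (D : ℝ) + -(D : ℝ) / 2 = 0 by ring, rpow_zero]
  have hexp : -‖√s • z‖ ^ 2 / (2 * s) = -‖z‖ ^ 2 / 2 := by
    rw [norm_smul, mul_pow, norm_of_nonneg (sqrt_nonneg s), sq_sqrt hs.le]
    field_simp
  rw [hexp, mul_rpow (by positivity) hs.le]
  linear_combination (-((2 * π) ^ (-(D : ℝ) / 2) * exp (-‖z‖ ^ 2 / 2))) * hpow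

/-- The joint density of a random vector `X` and its noisy version `a • X + √s • Z`. -/
theorem map_prodMk_add_smul_gaussian {D : ℕ} {Ω : Type*} [MeasurableSpace Ω] {μ : Measure Ω}
    [IsProbabilityMeasure μ] (a : ℝ) {s : ℝ} (hs : 0 < s)
    {p : EuclideanSpace ℝ (Fin D) → ℝ} (hp : Measurable p) (hp_nonneg : ∀ x, 0 ≤ p x)
    {X Z : Ω → EuclideanSpace ℝ (Fin D)} (hX : Measurable X) (hZ : Measurable Z)
    (hXlaw : μ.map X = volume.withDensity (fun x => ENNReal.ofReal (p x)))
    (hZlaw : μ.map Z = volume.withDensity (fun z =>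
      ENNReal.ofReal ((2 * π) ^ (-(D : ℝ) / 2) * exp (-‖z‖ ^ 2 / 2))))
    (hindep : IndepFun X Z μ) :
    μ.map (fun ω => (X ω, a • X ω + √s • Z ω)) =
      ((volume : Measure (EuclideanSpace ℝ (Fin D))).prod volume).withDensity (fun z =>
        ENNReal.ofReal (p z.1 * ((2 * π * s) ^ (-(D : ℝ) / 2) *
          exp (-‖z.2 - a • z.1‖ ^ 2 / (2 * s))))) := by
  have hb : 0 < √s := sqrt_pos.2 hs
  have hφ : Measurable fun z : EuclideanSpace ℝ (Fin D) =>
      ENNReal.ofReal ((2 * π) ^ (-(D : ℝ) / 2) * exp (-‖z‖ ^ 2 / 2)) := by fun_prop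
  have hk : Measurable fun z : EuclideanSpace ℝ (Fin D) × EuclideanSpace ℝ (Fin D) =>
      ENNReal.ofReal (p z.1 * ((2 * π * s) ^ (-(D : ℝ) / 2) *
        exp (-‖z.2 - a • z.1‖ ^ 2 / (2 * s)))) := by fun_prop
  have hT : Measurable fun z : EuclideanSpace ℝ (Fin D) × EuclideanSpace ℝ (Fin D) =>
      (z.1, a • z.1 + √s • z.2) := by fun_prop
  have hXZ : μ.map (fun ω => (X ω, Z ω)) =
      ((volume : Measure (EuclideanSpace ℝ (Fin D))).prod volume).withDensity (fun z =>
        ENNReal.ofReal (p z.1) *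
          ENNReal.ofReal ((2 * π) ^ (-(D : ℝ) / 2) * exp (-‖z.2‖ ^ 2 / 2))) := by
    rw [(indepFun_iff_map_prod_eq_prod_map_map hX.aemeasurable hZ.aemeasurable).1 hindep,
      hXlaw, hZlaw, prod_withDensity hp.ennreal_ofReal hφ]
  have hmap : μ.map (fun ω => (X ω, a • X ω + √s • Z ω)) =
      (μ.map fun ω => (X ω, Z ω)).map fun z => (z.1, a • z.1 + √s • z.2) := by
    rw [Measure.map_map hT (hX.prodMk hZ)]; rfl
  refine Measure.ext_of_lintegral _ fun f hf => ?_
  have hfT : Measurable fun z : EuclideanSpace ℝ (Fin D) × EuclideanSpace ℝ (Fin D) =>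
      f (z.1, a • z.1 + √s • z.2) := hf.comp hT
  rw [hmap, lintegral_map hf hT, hXZ, lintegral_withDensity_eq_lintegral_mul _ (by fun_prop) hfT,
    lintegral_withDensity_eq_lintegral_mul _ hk hf,
    lintegral_prod _ (by fun_prop), lintegral_prod _ (by fun_prop)]
  refine lintegral_congr fun x => ?_
  have hinner : Measurable fun y : EuclideanSpace ℝ (Fin D) =>
      ENNReal.ofReal (p x * ((2 * π * s) ^ (-(D : ℝ) / 2) *
        exp (-‖y - a • x‖ ^ 2 / (2 * s)))) * f (x, y) := by fun_prop
  have hcv := lintegral_comp_add_smul volume hinner (a • x) hb.ne'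
  rw [finrank_euclideanSpace_fin, abs_of_pos (by positivity)] at hcv
  have hcancel : ENNReal.ofReal (√s ^ D) * ENNReal.ofReal (√s ^ D)⁻¹ = 1 := by
    rw [← ENNReal.ofReal_mul (by positivity), mul_inv_cancel₀ (by positivity),
      ENNReal.ofReal_one]
  simp only [Pi.mul_apply]
  conv_rhs => rw [← one_mul (∫⁻ y, _ ∂volume), ← hcancel, mul_assoc, ← hcv,
    ← lintegral_const_mul _ (by fun_prop)]
  refine lintegral_congr fun z => ?_
  rw [gaussian_density_eq_pow_mul D hs z, add_sub_cancel_left,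
    ← ENNReal.ofReal_mul (hp_nonneg x), ← mul_assoc (ENNReal.ofReal (√s ^ D)),
    ← ENNReal.ofReal_mul (by positivity)]
  congr 2
  ring

/-- A Gaussian smoothing of a nonzero nonnegative density is strictly positive. -/
theorem integral_mul_gaussian_pos {E : Type*} [NormedAddCommGroup E] [NormedSpace ℝ E]
    [FiniteDimensional ℝ E] [MeasurableSpace E] [BorelSpace E]
    {ν : Measure E} {p : E → ℝ} (hp : Integrable p ν) (hp_nonneg : ∀ x, 0 ≤ p x)
    (hp_pos : 0 < ∫ x, p x ∂ν) (a : ℝ) {C s : ℝ} (hC : 0 < C) (hs : 0 ≤ s) (y : E) :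
    0 < ∫ x, p x * (C * exp (-‖y - a • x‖ ^ 2 / (2 * s))) ∂ν := by
  rw [integral_pos_iff_support_of_nonneg hp_nonneg hp] at hp_pos
  rw [integral_pos_iff_support_of_nonneg
    (fun x => mul_nonneg (hp_nonneg x) (by positivity))
    (integrable_mul_gaussian hp a C hs y)]
  convert hp_pos using 2
  ext x
  simp [hC.ne', (exp_pos _).ne']

theorem HasGradientAt.log {E : Type*} [NormedAddCommGroup E] [InnerProductSpace ℝ E]
    [CompleteSpace E] {f : E → ℝ} {f' x : E} (hf : HasGradientAt f f' x) (hx : f x ≠ 0) :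
    HasGradientAt (fun v => Real.log (f v)) ((f x)⁻¹ • f') x := by
  rw [hasGradientAt_iff_hasFDerivAt, map_smulₛₗ]
  exact hf.hasFDerivAt.log hx

/-- Tweedie's formula in the DDPM parameterization: if `X_t = √ᾱ • X₀ + √(1-ᾱ) • Z` with
`X₀` integrable with Lebesgue density `p`, `Z` an independent standard Gaussian, `ᾱ ∈ (0,1)`,
and `q` the Lebesgue density of `X_t` (the Gaussian smoothing of the law of `√ᾱ • X₀`), then
almost surely `E[X₀ ∣ X_t] = (X_t + (1-ᾱ) • ∇(log q)(X_t)) / √ᾱ`. -/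
theorem tweedie_formula_ddpm
    {D : ℕ} {Ω : Type*} [MeasurableSpace Ω] {μ : Measure Ω} [IsProbabilityMeasure μ]
    (ᾱ : ℝ) (hᾱ : ᾱ ∈ Set.Ioo (0 : ℝ) 1)
    (p : EuclideanSpace ℝ (Fin D) → ℝ)
    (hp_meas : Measurable p) (hp_nonneg : ∀ x, 0 ≤ p x)
    (hp_int : ∫ x, p x = 1)
    (X₀ Z : Ω → EuclideanSpace ℝ (Fin D))
    (hX₀ : Measurable X₀) (hZ : Measurable Z)
    (hX₀int : Integrable X₀ μ)
    (hX₀law : Measure.map X₀ μ = volume.withDensity (fun x => ENNReal.ofReal (p x)))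
    (hZlaw : Measure.map Z μ = volume.withDensity (fun z =>
      ENNReal.ofReal ((2 * π) ^ (-(D : ℝ) / 2) * Real.exp (-‖z‖ ^ 2 / 2))))
    (hindep : IndepFun X₀ Z μ)
    (Xt : Ω → EuclideanSpace ℝ (Fin D))
    (hXt : ∀ ω, Xt ω = Real.sqrt ᾱ • X₀ ω + Real.sqrt (1 - ᾱ) • Z ω)
    (q : EuclideanSpace ℝ (Fin D) → ℝ)
    (hq : ∀ y, q y = ∫ x, p x * ((2 * π * (1 - ᾱ)) ^ (-(D : ℝ) / 2) *
      Real.exp (-‖y - Real.sqrt ᾱ • x‖ ^ 2 / (2 * (1 - ᾱ))))) :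
    μ[X₀ | MeasurableSpace.comap Xt inferInstance] =ᵐ[μ]
      fun ω => (Real.sqrt ᾱ)⁻¹ •
        (Xt ω + (1 - ᾱ) • gradient (fun v => Real.log (q v)) (Xt ω)) := by
  have ha : 0 < √ᾱ := sqrt_pos.2 hᾱ.1
  have hs : 0 < 1 - ᾱ := sub_pos.2 hᾱ.2
  obtain rfl : Xt = fun ω => √ᾱ • X₀ ω + √(1 - ᾱ) • Z ω := funext hXt
  obtain rfl := funext hq
  have hp : Integrable p := .of_integral_ne_zero (by simp [hp_int])
  have hpx : Integrable fun x => p x • x := by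
    have h : Integrable (fun x => x) (μ.map X₀) :=
      (integrable_map_measure aestronglyMeasurable_id hX₀.aemeasurable).2 hX₀int
    rw [hX₀law, integrable_withDensity_iff_integrable_smul' hp_meas.ennreal_ofReal
      (by simp)] at h
    simpa [ENNReal.toReal_ofReal, hp_nonneg] using h
  have hC : 0 < (2 * π * (1 - ᾱ)) ^ (-(D : ℝ) / 2) := by positivity
  have hbayes := condExp_comap_ae_eq_of_map_prodMk_eq_withDensity hX₀
    (by fun_prop : Measurable fun ω => √ᾱ • X₀ ω + √(1 - ᾱ) • Z ω) hX₀int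
    (by fun_prop) (fun z => mul_nonneg (hp_nonneg z.1) (by positivity))
    (map_prodMk_add_smul_gaussian (√ᾱ) hs hp_meas hp_nonneg hX₀ hZ hX₀law hZlaw hindep)
  filter_upwards [hbayes] with ω hω
  rw [hω]
  generalize √ᾱ • X₀ ω + √(1 - ᾱ) • Z ω = y
  have hq_pos := integral_mul_gaussian_pos hp hp_nonneg (hp_int ▸ one_pos) (√ᾱ) hC hs.le y
  have hgrad := hasGradientAt_integral_mul_gaussian hp hpx (√ᾱ)
    ((2 * π * (1 - ᾱ)) ^ (-(D : ℝ) / 2)) hs y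
  rw [(hgrad.log hq_pos.ne').gradient, smul_comm _ (1 - ᾱ)⁻¹, smul_inv_smul₀ hs.ne', smul_sub,
    inv_smul_smul₀ hq_pos.ne', add_sub_cancel, smul_comm _ (√ᾱ), inv_smul_smul₀ ha.ne']
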